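/- Let g be a finite-dimensional unimodular real Lie algebra of dimension 2n that contains an abelian ideal a of codimension 2, and let J be a complex structure on g with J(a) ≠ a. If (g,J) admits a balanced Hermitian metric and also admits a pluriclosed Hermitian metric (possibly different), then (g,J) admits a Kähler Hermitian metric. -/

import Mathlib

open Module

section Defs

variable {L : Type*} [LieRing L] [LieAlgebra ℝ L]

/-- A complex structure on a real Lie algebra: `J² = -id` plus integrability. -/
def IsComplexStructure (J : L →ₗ[ℝ] L) : Prop :=
  (∀ x : L, J (J x) = -x) ∧
  (∀ x y : L, ⁅x, y⁆ - ⁅J x, J y⁆ + J ⁅J x, y⁆ + J ⁅x, J y⁆ = 0)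

/-- A Lie algebra is unimodular if every `ad x` is traceless. -/
def IsUnimodularLie (L : Type*) [LieRing L] [LieAlgebra ℝ L] : Prop :=
  ∀ x : L, LinearMap.trace ℝ L (LieAlgebra.ad ℝ L x) = 0

/-- A Hermitian metric on `(L, J)`: a `J`-compatible inner product. -/
structure HermMetric (J : L →ₗ[ℝ] L) : Type _ where
  B : L →ₗ[ℝ] L →ₗ[ℝ] ℝ
  symm : ∀ x y : L, B x y = B y x
  posdef : ∀ x : L, x ≠ 0 → 0 < B x x
  compat : ∀ x y : L, B (J x) (J y) = B x y

variable {J : L →ₗ[ℝ] L}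

/-- The Kähler form `ω(x,y) = ⟨Jx, y⟩`. -/
def HermMetric.omega (g : HermMetric J) (x y : L) : ℝ := g.B (J x) y

/-- Exterior differential of the Kähler form. -/
def HermMetric.dOmega (g : HermMetric J) (x y z : L) : ℝ :=
  - g.omega ⁅x, y⁆ z + g.omega ⁅x, z⁆ y - g.omega ⁅y, z⁆ x

/-- `dᶜω (x,y,z) = -dω(Jx, Jy, Jz)`. -/
def HermMetric.dcOmega (g : HermMetric J) (x y z : L) : ℝ :=
  - g.dOmega (J x) (J y) (J z)

/-- `d(dᶜω)` as a 4-form. -/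
def HermMetric.ddcOmega (g : HermMetric J) (x y z w : L) : ℝ :=
  - g.dcOmega ⁅x, y⁆ z w + g.dcOmega ⁅x, z⁆ y w - g.dcOmega ⁅x, w⁆ y z
  - g.dcOmega ⁅y, z⁆ x w + g.dcOmega ⁅y, w⁆ x z - g.dcOmega ⁅z, w⁆ x y

/-- The metric is Kähler if `dω = 0`. -/
def HermMetric.IsKahler (g : HermMetric J) : Prop :=
  ∀ x y z : L, g.dOmega x y z = 0

/-- The metric is pluriclosed if `d(dᶜω) = 0`. -/
def HermMetric.IsPluriclosed (g : HermMetric J) : Prop :=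
  ∀ x y z w : L, g.ddcOmega x y z w = 0

/-- The metric is balanced (dimension `2n`): for every orthonormal basis `f`,
`Σ_k dω(f_k, J f_k, x) = 0` for all `x`. -/
def HermMetric.IsBalanced (g : HermMetric J) (n : ℕ) : Prop :=
  ∀ f : Basis (Fin (2 * n)) ℝ L,
    (∀ i j, g.B (f i) (f j) = if i = j then 1 else 0) →
    ∀ x : L, (∑ k, g.dOmega (f k) (J (f k)) x) = 0

end Defs

section InnerProduct

variable {E : Type*} [NormedAddCommGroup E] [InnerProductSpace ℝ E] [FiniteDimensional ℝ E]

omit [FiniteDimensional ℝ E] in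
theorem inner_apply_apply_eq_sum {ι : Type*} [Fintype ι] (b : OrthonormalBasis ι ℝ E)
    (A : E →ₗ[ℝ] E) (i : ι) :
    inner ℝ (A (A (b i))) (b i) = ∑ j, inner ℝ (A (b i)) (b j) * inner ℝ (A (b j)) (b i) := by
  conv_lhs => rw [← b.sum_repr' (A (b i))]
  simp [map_sum, sum_inner, inner_smul_left, real_inner_comm]

/-- Two operators with `∑ (⟪A²u, u⟫ + ‖Au‖²) = 0` for all `u` are skew-adjoint: the trace of this
identity is half the sum of the squared norms of `A + A*`. -/
theorem inner_skew_of_sum_eq_zero (A₁ A₂ : E →ₗ[ℝ] E)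
    (h : ∀ u, inner ℝ (A₁ (A₁ u)) u + inner ℝ (A₁ u) (A₁ u)
      + (inner ℝ (A₂ (A₂ u)) u + inner ℝ (A₂ u) (A₂ u)) = 0) :
    (∀ u v, inner ℝ (A₁ u) v + inner ℝ u (A₁ v) = 0) ∧
      ∀ u v, inner ℝ (A₂ u) v + inner ℝ u (A₂ v) = 0 := by
  let b := stdOrthonormalBasis ℝ E
  have trace_sq (A : E →ₗ[ℝ] E) : ∑ i, ∑ j, (inner ℝ (A (b i)) (b j) + inner ℝ (A (b j)) (b i)) ^ 2
      = 2 * ∑ i, (inner ℝ (A (A (b i))) (b i) + inner ℝ (A (b i)) (A (b i))) := by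
    have hsq : ∀ i, inner ℝ (A (b i)) (A (b i)) = ∑ j, inner ℝ (A (b i)) (b j) ^ 2 := fun i => by
      rw [← b.sum_inner_mul_inner]
      exact Finset.sum_congr rfl fun j _ => by rw [real_inner_comm (A (b i)) (b j), sq]
    simp only [inner_apply_apply_eq_sum, hsq, Finset.sum_add_distrib, add_sq]
    rw [Finset.sum_comm (f := fun i j => inner ℝ (A (b j)) (b i) ^ 2)]
    simp only [mul_assoc, ← Finset.mul_sum]
    ring
  have skew_of_basis (A : E →ₗ[ℝ] E)
      (hA : ∀ i j, inner ℝ (A (b i)) (b j) + inner ℝ (A (b j)) (b i) = 0) :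
      ∀ u v, inner ℝ (A u) v + inner ℝ u (A v) = 0 := by
    have hform : (innerₗ E).comp A + (innerₗ E).compl₂ A = 0 := by
      refine b.toBasis.ext fun i => b.toBasis.ext fun j => ?_
      simpa [real_inner_comm] using hA i j
    intro u v
    simpa using LinearMap.congr_fun₂ hform u v
  have hsum : ∑ i, ∑ j, (inner ℝ (A₁ (b i)) (b j) + inner ℝ (A₁ (b j)) (b i)) ^ 2
      + ∑ i, ∑ j, (inner ℝ (A₂ (b i)) (b j) + inner ℝ (A₂ (b j)) (b i)) ^ 2 = 0 := by
    rw [trace_sq, trace_sq, ← mul_add, ← Finset.sum_add_distrib]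
    simp only [h, Finset.sum_const_zero, mul_zero]
  have sq_zero {S : Fin (finrank ℝ E) → Fin (finrank ℝ E) → ℝ} (hS : ∑ i, ∑ j, S i j ^ 2 = 0) :
      ∀ i j, S i j = 0 := fun i j => by
    have h1 := (Finset.sum_eq_zero_iff_of_nonneg
      fun i _ => Finset.sum_nonneg fun j _ => sq_nonneg (S i j)).1 hS i (Finset.mem_univ i)
    exact pow_eq_zero_iff two_ne_zero |>.1
      ((Finset.sum_eq_zero_iff_of_nonneg fun j _ => sq_nonneg _).1 h1 j (Finset.mem_univ j))
  have nonneg (A : E →ₗ[ℝ] E) :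
      0 ≤ ∑ i, ∑ j, (inner ℝ (A (b i)) (b j) + inner ℝ (A (b j)) (b i)) ^ 2 := by positivity
  have h₁ := nonneg A₁
  have h₂ := nonneg A₂
  exact ⟨skew_of_basis A₁ (sq_zero (by linarith)), skew_of_basis A₂ (sq_zero (by linarith))⟩

theorem trace_eq_zero_of_inner_skew (A : E →ₗ[ℝ] E)
    (hA : ∀ u v, inner ℝ (A u) v + inner ℝ u (A v) = 0) : LinearMap.trace ℝ E A = 0 := by
  rw [LinearMap.trace_eq_sum_inner A (stdOrthonormalBasis ℝ E)]
  refine Finset.sum_eq_zero fun i _ => ?_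
  have := hA (stdOrthonormalBasis ℝ E i) (stdOrthonormalBasis ℝ E i)
  rw [real_inner_comm] at this
  linarith

/-- A cocycle `(v₁, v₂)` for two commuting skew-adjoint operators is cohomologous to an invariant
one. -/
theorem exists_sub_mem_ker_of_inner_skew (A₁ A₂ : E →ₗ[ℝ] E)
    (h₁ : ∀ u v, inner ℝ (A₁ u) v + inner ℝ u (A₁ v) = 0)
    (h₂ : ∀ u v, inner ℝ (A₂ u) v + inner ℝ u (A₂ v) = 0)
    (hc : ∀ u, A₁ (A₂ u) = A₂ (A₁ u)) (v₁ v₂ : E) (hv : A₁ v₂ = A₂ v₁) :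
    ∃ t, A₁ (v₁ - A₁ t) = 0 ∧ A₂ (v₁ - A₁ t) = 0 ∧ A₁ (v₂ - A₂ t) = 0 ∧ A₂ (v₂ - A₂ t) = 0 := by
  have kill (r s : E) (h : A₁ r + A₂ s = 0) (h' : A₁ s = A₂ r) : A₁ r = 0 ∧ A₂ r = 0 := by
    have e₁ := h₁ r (A₁ r)
    have e₂ := h₂ s (A₁ r)
    have e₃ := h₁ s (A₂ r)
    rw [eq_neg_of_add_eq_zero_right h, inner_neg_left, ← hc] at e₂
    rw [h'] at e₃
    have p₁ := real_inner_self_nonneg (x := A₁ r)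
    have p₂ := real_inner_self_nonneg (x := A₂ r)
    exact ⟨(inner_self_eq_zero (𝕜 := ℝ)).1 (by linarith),
      (inner_self_eq_zero (𝕜 := ℝ)).1 (by linarith)⟩
  let S : E →ₗ[ℝ] E := A₁ ∘ₗ A₁ + A₂ ∘ₗ A₂
  have hS : S.IsSymmetric := fun u v => by
    have e₁ := h₁ (A₁ u) v
    have e₂ := h₁ u (A₁ v)
    have e₃ := h₂ (A₂ u) v
    have e₄ := h₂ u (A₂ v)
    simp only [S, LinearMap.add_apply, LinearMap.comp_apply, inner_add_left, inner_add_right]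
    linarith
  have hmem : A₁ v₁ + A₂ v₂ ∈ LinearMap.range S := by
    rw [← Submodule.orthogonal_orthogonal (LinearMap.range S), hS.orthogonal_range]
    intro u hu
    have hu' : A₁ (A₁ u) + A₂ (A₂ u) = 0 := hu
    have hk : A₁ u = 0 ∧ A₂ u = 0 := by
      have e₁ := h₁ u (A₁ u)
      have e₂ := h₂ u (A₂ u)
      have e₃ : inner ℝ u (A₁ (A₁ u)) + inner ℝ u (A₂ (A₂ u)) = 0 := by
        rw [← inner_add_right, hu', inner_zero_right]
      have p₁ := real_inner_self_nonneg (x := A₁ u)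
      have p₂ := real_inner_self_nonneg (x := A₂ u)
      exact ⟨(inner_self_eq_zero (𝕜 := ℝ)).1 (by linarith),
        (inner_self_eq_zero (𝕜 := ℝ)).1 (by linarith)⟩
    have e₁ := h₁ u v₁
    have e₂ := h₂ u v₂
    rw [hk.1, inner_zero_left] at e₁
    rw [hk.2, inner_zero_left] at e₂
    rw [inner_add_right]
    linarith
  obtain ⟨t, ht⟩ := hmem
  have ht' : A₁ (A₁ t) + A₂ (A₂ t) = A₁ v₁ + A₂ v₂ := ht
  have q₁ : A₁ (v₁ - A₁ t) + A₂ (v₂ - A₂ t) = 0 := by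
    simp only [map_sub]
    rw [← sub_eq_zero] at ht'
    rw [← neg_eq_zero, ← ht']
    abel
  have q₂ : A₁ (v₂ - A₂ t) = A₂ (v₁ - A₁ t) := by
    simp only [map_sub, hv, hc]
  obtain ⟨a₁, a₂⟩ := kill _ _ q₁ q₂
  refine ⟨t, a₁, a₂, q₂.trans a₂, ?_⟩
  simpa [a₁] using q₁

end InnerProduct

section Frame

variable {E : Type*} [NormedAddCommGroup E] [InnerProductSpace ℝ E] [FiniteDimensional ℝ E]

/-- A subspace of codimension two which is not invariant under an orthogonal complex structure is
transverse to its image. -/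
theorem sup_map_eq_top_of_codim_two (J : E →ₗ[ℝ] E) (hJ : ∀ x, J (J x) = -x)
    (hJi : ∀ x y, inner ℝ (J x) (J y) = inner ℝ x y) (a : Submodule ℝ E)
    (hcodim : finrank ℝ a + 2 = finrank ℝ E) (hJa : a.map J ≠ a) : a ⊔ a.map J = ⊤ := by
  by_contra hH
  set H := a ⊔ a.map J with hHdef
  have hJH : ∀ x ∈ H, J x ∈ H := by
    have : H ≤ H.comap J := sup_le
      (fun x hx => Submodule.mem_sup_right (Submodule.mem_map_of_mem hx))
      (by
        rintro _ ⟨x, hx, rfl⟩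
        have : J (J x) = -x := hJ x
        rw [Submodule.mem_comap, this]
        exact H.neg_mem (Submodule.mem_sup_left hx))
    exact this
  obtain ⟨y, hy, hy0⟩ := Submodule.exists_mem_ne_zero_of_ne_bot
    (mt Submodule.orthogonal_eq_bot_iff.1 hH)
  have hJy : J y ∈ Hᗮ := by
    intro x hx
    have h := hy (J x) (hJH x hx)
    have h' := hJi (J x) y
    rw [hJ, inner_neg_left] at h'
    linarith
  have hskew : inner ℝ y (J y) = 0 := by
    have h := hJi y (J y)
    rw [hJ, inner_neg_right, real_inner_comm] at h
    linarith
  have hJy0 : J y ≠ 0 := fun h => hy0 (by simpa [h] using (hJ y).symm)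
  have hli : LinearIndependent ℝ ![y, J y] := by
    refine linearIndependent_of_ne_zero_of_inner_eq_zero (𝕜 := ℝ) ?_ ?_
    · intro i; fin_cases i <;> simpa
    · intro i j hij
      fin_cases i <;> fin_cases j <;> simp_all [real_inner_comm]
  have hdim : 2 ≤ finrank ℝ Hᗮ := by
    have hli' : LinearIndependent ℝ (![⟨y, hy⟩, ⟨J y, hJy⟩] : Fin 2 → Hᗮ) := by
      refine LinearIndependent.of_comp Hᗮ.subtype ?_
      convert hli using 1
      ext i; fin_cases i <;> rfl
    simpa using hli'.fintype_card_le_finrank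
  have hHa : a = H := by
    refine Submodule.eq_of_le_of_finrank_le le_sup_left ?_
    have := H.finrank_add_finrank_orthogonal
    omega
  refine hJa (le_antisymm ?_ ?_)
  · rw [hHa] at hHdef ⊢
    rintro _ ⟨x, hx, rfl⟩
    exact hJH x hx
  · intro x hx
    have hx' : J x ∈ a := by rw [hHa]; exact hJH x (hHa ▸ hx)
    exact ⟨-J x, a.neg_mem hx', by simp [hJ]⟩

/-- A subspace of codimension two not invariant under an orthogonal complex structure `J` contains
an orthonormal pair, orthogonal to its maximal `J`-invariant subspace, whose image under `J` is a
basis of a complement. -/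
theorem exists_frame (J : E →ₗ[ℝ] E) (hJ : ∀ x, J (J x) = -x)
    (hJi : ∀ x y, inner ℝ (J x) (J y) = inner ℝ x y) (a : Submodule ℝ E)
    (hcodim : finrank ℝ a + 2 = finrank ℝ E) (hJa : a.map J ≠ a) :
    ∃ e₁ ∈ a, ∃ e₂ ∈ a, inner ℝ e₁ e₁ = 1 ∧ inner ℝ e₂ e₂ = 1 ∧ inner ℝ e₁ e₂ = 0 ∧
      (∀ v ∈ a, J v ∈ a → inner ℝ e₁ v = 0 ∧ inner ℝ e₂ v = 0) ∧
      ∃ ξ₁ ξ₂ : E →ₗ[ℝ] ℝ, ξ₁ (J e₁) = 1 ∧ ξ₁ (J e₂) = 0 ∧ ξ₂ (J e₁) = 0 ∧ ξ₂ (J e₂) = 1 ∧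
        ∀ x, x ∈ a ↔ ξ₁ x = 0 ∧ ξ₂ x = 0 := by
  have hmap : finrank ℝ (a.map J) = finrank ℝ a := by
    have hinj : Function.Injective J := fun x y h => by
      simpa [hJ] using congrArg J h
    exact (Submodule.equivMapOfInjective J hinj a).finrank_eq.symm
  have hV : ∀ v, v ∈ a ⊓ a.map J ↔ v ∈ a ∧ J v ∈ a := by
    intro v
    refine and_congr_right fun _ => ⟨?_, fun h => ⟨-J v, a.neg_mem h, by simp [hJ]⟩⟩
    rintro ⟨x, hx, rfl⟩
    rw [hJ]
    exact a.neg_mem hx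
  have hdim : finrank ℝ ((a ⊓ a.map J)ᗮ ⊓ a : Submodule ℝ E) = 2 := by
    have h₁ := Submodule.finrank_add_inf_finrank_orthogonal (𝕜 := ℝ)
      (inf_le_left : a ⊓ a.map J ≤ a)
    have h₂ := Submodule.finrank_sup_add_finrank_inf_eq a (a.map J)
    rw [sup_map_eq_top_of_codim_two J hJ hJi a hcodim hJa, finrank_top] at h₂
    omega
  let b := (stdOrthonormalBasis ℝ ((a ⊓ a.map J)ᗮ ⊓ a : Submodule ℝ E)).reindex (finCongr hdim)
  have hb (i j) : inner ℝ (b i : E) (b j) = if i = j then 1 else 0 := by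
    rw [← Submodule.coe_inner, b.inner_eq_ite]
  have hba (i) : (b i : E) ∈ a := (b i).2.2
  have hbo (i) (v) (hv : v ∈ a) (hv' : J v ∈ a) : inner ℝ (b i : E) v = 0 := by
    rw [real_inner_comm]
    exact (b i).2.1 v ((hV v).2 ⟨hv, hv'⟩)
  have hli : LinearIndependent ℝ fun i => a.mkQ (J (b i)) := by
    rw [Fintype.linearIndependent_iff]
    intro c hc i
    simp only [Fin.sum_univ_two, ← map_smul, ← map_add] at hc
    rw [Submodule.mkQ_apply, Submodule.Quotient.mk_eq_zero] at hc
    have h := hbo i _ (a.add_mem (a.smul_mem _ (hba 0)) (a.smul_mem _ (hba 1))) hc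
    rw [inner_add_right, inner_smul_right, inner_smul_right, hb, hb] at h
    fin_cases i <;> simpa using h
  have hcard : Fintype.card (Fin 2) = finrank ℝ (E ⧸ a) := by
    have := a.finrank_quotient_add_finrank
    simp
    omega
  let q := basisOfLinearIndependentOfCardEqFinrank hli hcard
  have hq (i) : q i = a.mkQ (J (b i)) := by simp [q]
  refine ⟨b 0, hba 0, b 1, hba 1, (hb 0 0).trans (by simp), (hb 1 1).trans (by simp),
    (hb 0 1).trans (by simp),
    fun v hv hv' => ⟨hbo 0 v hv hv', hbo 1 v hv hv'⟩, q.coord 0 ∘ₗ a.mkQ, q.coord 1 ∘ₗ a.mkQ,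
    ?_, ?_, ?_, ?_, ?_⟩
  iterate 4 rw [LinearMap.comp_apply, ← hq]; simp
  intro x
  rw [← Submodule.Quotient.mk_eq_zero, ← q.forall_coord_eq_zero_iff, Fin.forall_fin_two]
  rfl

theorem exists_orthonormalBasis_sum_eq {F ι : Type*} [AddCommMonoid F] [Fintype ι] {m : ℕ}
    (hm : finrank ℝ E = m) (φ : E → F) (w : ι → E) (hw : Orthonormal ℝ w)
    (hφ : ∀ x, (∀ i, inner ℝ (w i) x = 0) → φ x = 0) :
    ∃ b : OrthonormalBasis (Fin m) ℝ E, ∑ k, φ (b k) = ∑ i, φ (w i) := by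
  classical
  have hle : Fintype.card ι ≤ Fintype.card (Fin m) := by
    simpa [hm] using hw.linearIndependent.fintype_card_le_finrank
  obtain ⟨c⟩ := Function.Embedding.nonempty_of_card_le hle
  have hv : Orthonormal ℝ ((Set.range c).domRestrict (Function.extend c w 0)) := by
    have h := hw.comp (Equiv.ofInjective c c.injective).symm (Equiv.injective _)
    convert h using 1
    ext ⟨_, i, rfl⟩
    simp [c.injective.extend_apply]
  obtain ⟨b, hb⟩ := hv.exists_orthonormalBasis_extension_of_card_eq (by simpa using hm)
  have hbc (i) : b (c i) = w i := by
    rw [hb _ ⟨i, rfl⟩, c.injective.extend_apply]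
  refine ⟨b, ?_⟩
  simp only [← hbc]
  rw [← Finset.sum_map Finset.univ c fun k => φ (b k)]
  refine (Finset.sum_subset (Finset.subset_univ _) fun k _ hk => hφ _ fun i => ?_).symm
  rw [← hbc, b.inner_eq_ite, if_neg]
  rintro rfl
  exact hk (Finset.mem_map_of_mem c (Finset.mem_univ i))

/-- The sum of a quadratic expression `β x (J x)` over suitable unitary bases, when `β` vanishes
on the maximal `J`-invariant subspace of `a`. -/
theorem exists_frame_sum_eq {F : Type*} [AddCommGroup F] [Module ℝ F] (J : E →ₗ[ℝ] E)
    (hJ : ∀ x, J (J x) = -x) (hJi : ∀ x y, inner ℝ (J x) (J y) = inner ℝ x y)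
    (a : Submodule ℝ E) (hcodim : finrank ℝ a + 2 = finrank ℝ E) (hJa : a.map J ≠ a)
    (β : E →ₗ[ℝ] E →ₗ[ℝ] F) (hβ : ∀ x, β x x = 0) (hβa : ∀ x ∈ a, ∀ y ∈ a, β x y = 0)
    {m : ℕ} (hm : finrank ℝ E = m)
    (hsum : ∀ b : OrthonormalBasis (Fin m) ℝ E, ∑ k, β (b k) (J (b k)) = 0) :
    ∃ e₁ ∈ a, ∃ e₂ ∈ a, ∃ s : ℝ, s ^ 2 < 1 ∧
      β (J e₁) e₁ + β (J e₂) e₂ = s • β (J e₁) (J e₂) ∧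
      ∃ ξ₁ ξ₂ : E →ₗ[ℝ] ℝ, ξ₁ (J e₁) = 1 ∧ ξ₁ (J e₂) = 0 ∧ ξ₂ (J e₁) = 0 ∧ ξ₂ (J e₂) = 1 ∧
        ∀ x, x ∈ a ↔ ξ₁ x = 0 ∧ ξ₂ x = 0 := by
  obtain ⟨e₁, h₁, e₂, h₂, n₁, n₂, n₁₂, ho, ξ₁, ξ₂, x₁₁, x₁₂, x₂₁, x₂₂, hξ⟩ :=
    exists_frame J hJ hJi a hcodim hJa
  have hskew (x y) : inner ℝ (J x) y = -inner ℝ x (J y) := by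
    rw [← hJi x (J y), hJ, inner_neg_right, neg_neg]
  have hself (x) : inner ℝ x (J x) = 0 := by
    have := hskew x x
    rw [real_inner_comm] at this
    linarith
  have hβs (x y) : β y x = -β x y := by
    have := hβ (x + y)
    simp only [map_add, LinearMap.add_apply, hβ, zero_add, add_zero] at this
    exact eq_neg_of_add_eq_zero_left this
  set s := inner ℝ e₁ (J e₂) with hs
  have hs' : inner ℝ e₂ (J e₁) = -s := by rw [real_inner_comm, hskew]
  have n₂₁ : inner ℝ e₂ e₁ = 0 := by rw [real_inner_comm, n₁₂]
  have hnorm : inner ℝ (e₂ + s • J e₁) (e₂ + s • J e₁) = 1 - s ^ 2 := by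
    simp only [inner_add_left, inner_add_right, inner_smul_left, inner_smul_right, hJi, hskew, n₁,
      n₂, ← hs, hs', conj_trivial]
    ring
  have hs1 : s ^ 2 < 1 := by
    have hne : e₂ + s • J e₁ ≠ 0 := by
      intro h0
      have := congrArg ξ₂ (congrArg J h0)
      simp [hJ, x₂₂, ((hξ e₁).1 h₁).2] at this
    have := real_inner_self_pos.2 hne
    linarith
  obtain ⟨r, hr⟩ : ∃ r : ℝ, r ^ 2 * (1 - s ^ 2) = 1 :=
    ⟨(√(1 - s ^ 2))⁻¹, by
      rw [inv_pow, Real.sq_sqrt (by linarith)]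
      exact inv_mul_cancel₀ (by linarith)⟩
  set f := r • (e₂ + s • J e₁) with hf
  have hff : inner ℝ f f = 1 := by
    rw [hf, inner_smul_left, inner_smul_right, hnorm, conj_trivial]
    linear_combination hr
  have he₁f : inner ℝ e₁ f = 0 := by
    simp [hf, inner_add_right, inner_smul_right, n₁₂, hself]
  have hJe₁f : inner ℝ (J e₁) f = 0 := by
    rw [hf, inner_smul_right, inner_add_right, inner_smul_right, hJi, n₁, real_inner_comm, hs']
    ring
  have hw : Orthonormal ℝ ![e₁, J e₁, f, J f] := by
    rw [orthonormal_iff_ite]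
    have hfe₁ : inner ℝ f e₁ = 0 := by rw [real_inner_comm, he₁f]
    have hfJe₁ : inner ℝ f (J e₁) = 0 := by rw [real_inner_comm, hJe₁f]
    have he₁Jf : inner ℝ e₁ (J f) = 0 := by rw [← neg_eq_zero, ← hskew, hJe₁f]
    intro i j
    fin_cases i <;> fin_cases j <;>
      simp [-inner_self_eq_norm_sq_to_K, hJi, hself, hskew, n₁, hff,
        he₁f, hfe₁, hfJe₁, he₁Jf]
  have hvanish (x : E) (hx : ∀ i, inner ℝ (![e₁, J e₁, f, J f] i) x = 0) : β x (J x) = 0 := by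
    have hr0 : r ≠ 0 := by
      rintro rfl
      simp at hr
    have y₁ : inner ℝ e₁ x = 0 := hx 0
    have y₂ : inner ℝ (J e₁) x = 0 := hx 1
    have y₃ : inner ℝ e₂ x = 0 := by
      have h : inner ℝ f x = 0 := hx 2
      simpa [hf, inner_smul_left, inner_add_left, y₂, hr0] using h
    have y₄ : inner ℝ (J e₂) x = 0 := by
      have h : inner ℝ (J f) x = 0 := hx 3
      simpa [hf, hJ, inner_smul_left, inner_add_left, y₁, hr0] using h
    set y := x - ξ₁ x • J e₁ - ξ₂ x • J e₂ with hy
    have hya : y ∈ a := (hξ y).2 (by simp [hy, x₁₁, x₁₂, x₂₁, x₂₂])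
    set v := y - ξ₁ (J y) • e₁ - ξ₂ (J y) • e₂ with hv
    have hva : v ∈ a := a.sub_mem (a.sub_mem hya (a.smul_mem _ h₁)) (a.smul_mem _ h₂)
    have hJva : J v ∈ a := (hξ _).2 (by
      rw [hv]
      simp only [map_sub, map_smul, x₁₁, x₁₂, x₂₁, x₂₂, smul_eq_mul]
      constructor <;> ring)
    obtain ⟨v₁, v₂⟩ := ho v hva hJva
    obtain ⟨v₃, v₄⟩ := ho (J v) hJva (by rw [hJ]; exact a.neg_mem hva)
    have hxv : x - v = 0 := by
      rw [← inner_self_eq_zero (𝕜 := ℝ)]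
      have hw : x - v
          = ξ₁ x • J e₁ + ξ₂ x • J e₂ + ξ₁ (J y) • e₁ + ξ₂ (J y) • e₂ := by
        rw [hv, hy]
        abel
      nth_rw 1 [hw]
      simp only [inner_add_left, inner_smul_left, inner_sub_right, y₁, y₂, y₃, y₄, v₁, v₂,
        hskew _ v, v₃, v₄]
      simp
    rw [sub_eq_zero.1 hxv]
    exact hβa v hva (J v) hJva
  obtain ⟨b, hb⟩ := exists_orthonormalBasis_sum_eq hm (fun x => β x (J x)) _ hw hvanish
  rw [hsum b, Fin.sum_univ_four] at hb
  refine ⟨e₁, h₁, e₂, h₂, s, hs1, ?_, ξ₁, ξ₂, x₁₁, x₁₂, x₂₁, x₂₂, hξ⟩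
  have hff' : β f (J f)
      = r ^ 2 • (s • β (J e₁) (J e₂) - β (J e₂) e₂ - s ^ 2 • β (J e₁) e₁) := by
    simp only [hf, map_add, map_smul, LinearMap.add_apply, LinearMap.smul_apply, hJ, map_neg,
      hβa e₂ h₂ e₁ h₁, hβs (J e₂) e₂]
    module
  simp only [Matrix.cons_val, hJ, map_neg, hβs e₁ (J e₁), hβs f (J f), neg_neg] at hb
  rw [hβs (J e₁) e₁, hff'] at hb
  have hmul : (r ^ 2 * (1 - s ^ 2)) • β (J e₁) e₁ = β (J e₁) e₁ := by rw [hr, one_smul]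
  have hr0 : r ^ 2 ≠ 0 := left_ne_zero_of_mul_eq_one hr
  refine smul_right_injective F hr0 (sub_eq_zero.1 ?_)
  simp only
  linear_combination (norm := module) (1 / 2 : ℝ) • hb + hmul

end Frame

section Form

variable {E : Type*} [AddCommGroup E] [Module ℝ E]

/-- The inner product defined by a positive definite symmetric bilinear form. -/
abbrev innerCoreOfForm (B : E →ₗ[ℝ] E →ₗ[ℝ] ℝ) (hs : ∀ x y, B x y = B y x)
    (hp : ∀ x, x ≠ 0 → 0 < B x x) : InnerProductSpace.Core ℝ E where
  inner x y := B x y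
  conj_inner_symm x y := by simpa using hs y x
  re_inner_nonneg x := by
    by_cases hx : x = 0
    · simp [hx]
    · simpa using (hp x hx).le
  add_left x y z := by simp
  smul_left x y r := by simp
  definite x h := by
    by_contra hx
    exact (hp x hx).ne' h

variable [FiniteDimensional ℝ E] (B : E →ₗ[ℝ] E →ₗ[ℝ] ℝ) (hs : ∀ x y, B x y = B y x)
  (hp : ∀ x, x ≠ 0 → 0 < B x x)

include hs hp

theorem skew_of_form (A₁ A₂ : E →ₗ[ℝ] E)
    (h : ∀ u, B (A₁ (A₁ u)) u + B (A₁ u) (A₁ u) + (B (A₂ (A₂ u)) u + B (A₂ u) (A₂ u)) = 0) :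
    (∀ u v, B (A₁ u) v + B u (A₁ v) = 0) ∧ ∀ u v, B (A₂ u) v + B u (A₂ v) = 0 := by
  let c := innerCoreOfForm B hs hp
  let _ : NormedAddCommGroup E := c.toNormedAddCommGroup
  let _ : InnerProductSpace ℝ E := .ofCore c.toCore
  exact inner_skew_of_sum_eq_zero A₁ A₂ h

theorem trace_eq_zero_of_skew (A : E →ₗ[ℝ] E) (h : ∀ u v, B (A u) v + B u (A v) = 0) :
    LinearMap.trace ℝ E A = 0 := by
  let c := innerCoreOfForm B hs hp
  let _ : NormedAddCommGroup E := c.toNormedAddCommGroup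
  let _ : InnerProductSpace ℝ E := .ofCore c.toCore
  exact trace_eq_zero_of_inner_skew A h

theorem exists_sub_mem_ker_of_skew (A₁ A₂ : E →ₗ[ℝ] E)
    (h₁ : ∀ u v, B (A₁ u) v + B u (A₁ v) = 0) (h₂ : ∀ u v, B (A₂ u) v + B u (A₂ v) = 0)
    (hc : ∀ u, A₁ (A₂ u) = A₂ (A₁ u)) (v₁ v₂ : E) (hv : A₁ v₂ = A₂ v₁) :
    ∃ t, A₁ (v₁ - A₁ t) = 0 ∧ A₂ (v₁ - A₁ t) = 0 ∧ A₁ (v₂ - A₂ t) = 0 ∧ A₂ (v₂ - A₂ t) = 0 := by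
  let c := innerCoreOfForm B hs hp
  let _ : NormedAddCommGroup E := c.toNormedAddCommGroup
  let _ : InnerProductSpace ℝ E := .ofCore c.toCore
  exact exists_sub_mem_ker_of_inner_skew A₁ A₂ h₁ h₂ hc v₁ v₂ hv

theorem exists_frame_sum_eq_of_form {F : Type*} [AddCommGroup F] [Module ℝ F] (J : E →ₗ[ℝ] E)
    (hJ : ∀ x, J (J x) = -x) (hJi : ∀ x y, B (J x) (J y) = B x y)
    (a : Submodule ℝ E) (hcodim : finrank ℝ a + 2 = finrank ℝ E) (hJa : a.map J ≠ a)
    (β : E →ₗ[ℝ] E →ₗ[ℝ] F) (hβ : ∀ x, β x x = 0) (hβa : ∀ x ∈ a, ∀ y ∈ a, β x y = 0)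
    {m : ℕ} (hm : finrank ℝ E = m)
    (hsum : ∀ b : Basis (Fin m) ℝ E, (∀ i j, B (b i) (b j) = if i = j then 1 else 0) →
      ∑ k, β (b k) (J (b k)) = 0) :
    ∃ e₁ ∈ a, ∃ e₂ ∈ a, ∃ s : ℝ, s ^ 2 < 1 ∧
      β (J e₁) e₁ + β (J e₂) e₂ = s • β (J e₁) (J e₂) ∧
      ∃ ξ₁ ξ₂ : E →ₗ[ℝ] ℝ, ξ₁ (J e₁) = 1 ∧ ξ₁ (J e₂) = 0 ∧ ξ₂ (J e₁) = 0 ∧ ξ₂ (J e₂) = 1 ∧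
        ∀ x, x ∈ a ↔ ξ₁ x = 0 ∧ ξ₂ x = 0 := by
  let c := innerCoreOfForm B hs hp
  let _ : NormedAddCommGroup E := c.toNormedAddCommGroup
  let _ : InnerProductSpace ℝ E := .ofCore c.toCore
  refine exists_frame_sum_eq J hJ hJi a hcodim hJa β hβ hβa hm fun b => ?_
  have h := hsum b.toBasis fun i j => by
    rw [b.coe_toBasis]
    exact b.inner_eq_ite i j
  simpa using h

omit [FiniteDimensional ℝ E] hs hp in
theorem trace_eq_sum_of_orthonormal {ι : Type*} [Fintype ι] [DecidableEq ι] (b : Basis ι ℝ E)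
    (hb : ∀ i j, B (b i) (b j) = if i = j then 1 else 0) (T : E →ₗ[ℝ] E) :
    LinearMap.trace ℝ E T = ∑ k, B (T (b k)) (b k) := by
  rw [LinearMap.trace_eq_matrix_trace ℝ b, Matrix.trace]
  refine Finset.sum_congr rfl fun k _ => ?_
  rw [Matrix.diag_apply, LinearMap.toMatrix_apply]
  conv_rhs => rw [← b.sum_repr (T (b k))]
  rw [map_sum, LinearMap.sum_apply]
  simp [hb]

end Form

section Lie

variable {L : Type*} [LieRing L] [LieAlgebra ℝ L] {J : L →ₗ[ℝ] L}

theorem HermMetric.apply_J_left (g : HermMetric J) (hJ : ∀ x, J (J x) = -x) (x y : L) :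
    g.B (J x) y = -g.B x (J y) := by
  rw [← g.compat x (J y), hJ, map_neg, neg_neg]

/-- On a unimodular Lie algebra the balanced condition says that `∑ ⁅f k, J (f k)⁆ = 0`. -/
theorem HermMetric.IsBalanced.sum_lie_eq_zero {g : HermMetric J} {n : ℕ} (hg : g.IsBalanced n)
    (hJ : ∀ x, J (J x) = -x) (huni : IsUnimodularLie L) (f : Basis (Fin (2 * n)) ℝ L)
    (hf : ∀ i j, g.B (f i) (f j) = if i = j then 1 else 0) :
    ∑ k, ⁅f k, J (f k)⁆ = 0 := by
  have trace_lie (b : Basis (Fin (2 * n)) ℝ L)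
      (hb : ∀ i j, g.B (b i) (b j) = if i = j then 1 else 0) (x : L) :
      ∑ k, g.B ⁅b k, x⁆ (b k) = 0 := by
    have h := trace_eq_sum_of_orthonormal g.B b hb (LieAlgebra.ad ℝ L x)
    rw [huni] at h
    simp only [LieAlgebra.ad_apply] at h
    rw [← neg_eq_zero, ← Finset.sum_neg_distrib, h]
    exact Finset.sum_congr rfl fun k _ => by
      rw [← lie_skew x (b k), map_neg, LinearMap.neg_apply]
  let e : L ≃ₗ[ℝ] L := LinearEquiv.ofLinearMap J (-J) (by ext x; simp [hJ]) (by ext x; simp [hJ])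
  have hsum (x : L) : g.B (J (∑ k, ⁅f k, J (f k)⁆)) x = 0 := by
    have h := hg f hf x
    have h₁ := trace_lie f hf x
    have h₂ := trace_lie (f.map e) (fun i j => by simpa [e, g.compat] using hf i j) x
    have hterm (k) : g.dOmega (f k) (J (f k)) x = -g.B (J ⁅f k, J (f k)⁆) x
        + g.B ⁅f k, x⁆ (f k) + g.B ⁅f.map e k, x⁆ (f.map e k) := by
      simp only [HermMetric.dOmega, HermMetric.omega, g.compat, g.apply_J_left hJ ⁅J (f k), x⁆]
      simp [e]
    simp only [hterm, Finset.sum_add_distrib, h₁, h₂, Finset.sum_neg_distrib] at h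
    simpa using h
  by_contra hne
  have hpos := g.posdef _ hne
  have h := hsum (J (∑ k, ⁅f k, J (f k)⁆))
  rw [g.compat] at h
  exact hpos.not_ge h.le

/-- An abelian ideal `a` together with a pair `e₁, e₂ ∈ a` such that `J e₁, J e₂` is a basis of
a complement of `a`, with coordinate functionals `ξ₁, ξ₂`. -/
structure IsFrame (J : L →ₗ[ℝ] L) (a : LieIdeal ℝ L) (e₁ e₂ : L) (ξ₁ ξ₂ : L →ₗ[ℝ] ℝ) : Prop where
  lie_eq_zero : ∀ u ∈ a, ∀ v ∈ a, ⁅u, v⁆ = 0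
  sq : ∀ x, J (J x) = -x
  integrable : ∀ x y : L, ⁅x, y⁆ - ⁅J x, J y⁆ + J ⁅J x, y⁆ + J ⁅x, J y⁆ = 0
  left_mem : e₁ ∈ a
  right_mem : e₂ ∈ a
  ξ₁_left : ξ₁ (J e₁) = 1
  ξ₁_right : ξ₁ (J e₂) = 0
  ξ₂_left : ξ₂ (J e₁) = 0
  ξ₂_right : ξ₂ (J e₂) = 1
  mem_iff : ∀ x, x ∈ a ↔ ξ₁ x = 0 ∧ ξ₂ x = 0

/-- The maximal `J`-invariant subspace of `a`. -/
def invCore (J : L →ₗ[ℝ] L) (a : LieIdeal ℝ L) : Submodule ℝ L :=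
  a.toSubmodule ⊓ a.toSubmodule.comap J

theorem mem_invCore {a : LieIdeal ℝ L} {x : L} : x ∈ invCore J a ↔ x ∈ a ∧ J x ∈ a := Iff.rfl

namespace IsFrame

variable {a : LieIdeal ℝ L} {e₁ e₂ : L} {ξ₁ ξ₂ : L →ₗ[ℝ] ℝ} (h : IsFrame J a e₁ e₂ ξ₁ ξ₂)

include h

theorem J_mem {u : L} (hu : u ∈ invCore J a) : J u ∈ invCore J a :=
  mem_invCore.2 ⟨hu.2, by rw [h.sq]; exact a.neg_mem hu.1⟩

theorem ξ_mem {u : L} (hu : u ∈ a) : ξ₁ u = 0 ∧ ξ₂ u = 0 := (h.mem_iff u).1 hu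

/-- Modulo `a`, every element is a combination of `J e₁` and `J e₂`. -/
theorem sub_mem_ideal (x : L) : x - (ξ₁ x • J e₁ + ξ₂ x • J e₂) ∈ a :=
  (h.mem_iff _).2 (by simp [h.ξ₁_left, h.ξ₁_right, h.ξ₂_left, h.ξ₂_right])

/-- Modulo the maximal `J`-invariant subspace, every element of `a` is a combination of
`e₁` and `e₂`. -/
theorem sub_mem_invCore {y : L} (hy : y ∈ a) :
    y - (ξ₁ (J y) • e₁ + ξ₂ (J y) • e₂) ∈ invCore J a :=
  mem_invCore.2 ⟨a.sub_mem hy (a.add_mem (a.smul_mem _ h.left_mem) (a.smul_mem _ h.right_mem)),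
    by simpa using h.sub_mem_ideal (J y)⟩

theorem lie_eq (x : L) {u : L} (hu : u ∈ a) :
    ⁅x, u⁆ = ξ₁ x • ⁅J e₁, u⁆ + ξ₂ x • ⁅J e₂, u⁆ := by
  have := h.lie_eq_zero _ (h.sub_mem_ideal x) u hu
  rw [sub_lie, add_lie, smul_lie, smul_lie] at this
  exact sub_eq_zero.1 this

theorem lie_J_of_mem {e u : L} (he : e ∈ a) (hu : u ∈ invCore J a) :
    ⁅J e, J u⁆ = J ⁅J e, u⁆ := by
  have := h.integrable e u
  rw [h.lie_eq_zero e he u hu.1, h.lie_eq_zero e he (J u) hu.2, map_zero, add_zero, zero_sub,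
    neg_add_eq_zero] at this
  exact this

theorem lie_J (x : L) {u : L} (hu : u ∈ invCore J a) : ⁅x, J u⁆ = J ⁅x, u⁆ := by
  rw [h.lie_eq x hu.1, h.lie_eq x hu.2, h.lie_J_of_mem h.left_mem hu,
    h.lie_J_of_mem h.right_mem hu]
  simp

theorem lie_mem_invCore (x : L) {u : L} (hu : u ∈ invCore J a) : ⁅x, u⁆ ∈ invCore J a :=
  mem_invCore.2 ⟨a.lie_mem hu.1, by rw [← h.lie_J x hu]; exact a.lie_mem hu.2⟩

theorem lie_J_J : ⁅J e₁, J e₂⁆ = J (⁅J e₁, e₂⁆ - ⁅J e₂, e₁⁆) := by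
  have := h.integrable e₁ e₂
  rw [h.lie_eq_zero e₁ h.left_mem e₂ h.right_mem, ← lie_skew e₁ (J e₂), map_neg] at this
  rw [map_sub, ← sub_eq_zero, ← neg_eq_zero, ← this]
  abel

theorem J_lie_J_J_mem : J ⁅J e₁, J e₂⁆ ∈ a := by
  rw [h.lie_J_J, h.sq]
  exact a.neg_mem (a.sub_mem (a.lie_mem h.right_mem) (a.lie_mem h.left_mem))

theorem dOmega_eq_zero (g : HermMetric J) {x y z : L} (hx : x ∈ a) (hy : y ∈ a) (hz : z ∈ a) :
    g.dOmega x y z = 0 := by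
  simp [HermMetric.dOmega, HermMetric.omega, h.lie_eq_zero x hx y hy, h.lie_eq_zero x hx z hz,
    h.lie_eq_zero y hy z hz]

theorem ddcOmega_invCore (g : HermMetric J) {e u : L} (he : e ∈ a) (hu : u ∈ invCore J a) :
    g.ddcOmega (J e) e u (J u) = -g.dcOmega ⁅J e, e⁆ u (J u)
      - 2 * (g.B ⁅J e, ⁅J e, u⁆⁆ u + g.B ⁅J e, u⁆ ⁅J e, u⁆) := by
  have hJu := h.J_mem hu
  have hA := h.lie_mem_invCore (J e) hu
  have hJA := h.J_mem hA
  have hAA := h.lie_mem_invCore (J e) hA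
  have t₁ : g.dcOmega ⁅J e, u⁆ e (J u)
      = -(g.B ⁅J e, ⁅J e, u⁆⁆ u + g.B ⁅J e, u⁆ ⁅J e, u⁆) := by
    simp only [HermMetric.dcOmega, HermMetric.dOmega, HermMetric.omega, h.sq,
      lie_neg, map_neg, LinearMap.neg_apply, ← lie_skew (J ⁅J e, u⁆) (J e), h.lie_J _ hA,
      h.lie_eq_zero _ hJA.1 _ hu.1, map_zero, LinearMap.zero_apply, g.compat]
    ring
  have t₂ : g.dcOmega ⁅J e, J u⁆ e u = g.B ⁅J e, ⁅J e, u⁆⁆ u + g.B ⁅J e, u⁆ ⁅J e, u⁆ := by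
    simp only [HermMetric.dcOmega, HermMetric.dOmega, HermMetric.omega, h.sq, h.lie_J _ hu,
      neg_lie, map_neg, LinearMap.neg_apply, ← lie_skew ⁅J e, u⁆ (J e), g.compat,
      h.lie_eq_zero _ hA.1 _ hu.1, map_zero, LinearMap.zero_apply]
    ring
  have z (x y : L) : g.dcOmega 0 x y = 0 := by
    simp [HermMetric.dcOmega, HermMetric.dOmega, HermMetric.omega]
  rw [HermMetric.ddcOmega, t₁, t₂, h.lie_eq_zero e he u hu.1, h.lie_eq_zero e he _ hJu.1,
    h.lie_eq_zero u hu.1 _ hJu.1, z, z, z]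
  ring

/-- The adjoint action on the maximal `J`-invariant subspace of `a`. -/
def adCore (x : L) : invCore J a →ₗ[ℝ] invCore J a :=
  (LieAlgebra.ad ℝ L x : L →ₗ[ℝ] L).restrict fun _ hu => h.lie_mem_invCore x hu

theorem coe_adCore (x : L) (u : invCore J a) : (h.adCore x u : L) = ⁅x, (u : L)⁆ := rfl

/-- The restriction of a Hermitian metric to the maximal `J`-invariant subspace of `a`. -/
def coreForm (_ : IsFrame J a e₁ e₂ ξ₁ ξ₂) (g : HermMetric J) :
    invCore J a →ₗ[ℝ] invCore J a →ₗ[ℝ] ℝ :=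
  g.B.domRestrict₁₂ (invCore J a) (invCore J a)

theorem coreForm_apply (g : HermMetric J) (u v : invCore J a) :
    h.coreForm g u v = g.B (u : L) (v : L) := rfl

theorem coreForm_symm (g : HermMetric J) (u v : invCore J a) :
    h.coreForm g u v = h.coreForm g v u := g.symm _ _

theorem coreForm_posdef (g : HermMetric J) (u : invCore J a) (hu : u ≠ 0) :
    0 < h.coreForm g u u := g.posdef _ (by simpa using hu)

/-- If `g` is pluriclosed and the frame satisfies the balanced identity, then `g` is invariant
under the adjoint action on the maximal `J`-invariant subspace of `a`. -/
theorem skew_of_isPluriclosed [FiniteDimensional ℝ L] {g : HermMetric J} (hg : g.IsPluriclosed)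
    {s : ℝ} (hb : ⁅J e₁, e₁⁆ + ⁅J e₂, e₂⁆ = s • ⁅J e₁, J e₂⁆) (x : L) (u v : invCore J a) :
    h.coreForm g (h.adCore x u) v + h.coreForm g u (h.adCore x v) = 0 := by
  have key (u : invCore J a) :
      h.coreForm g (h.adCore (J e₁) (h.adCore (J e₁) u)) u
        + h.coreForm g (h.adCore (J e₁) u) (h.adCore (J e₁) u)
      + (h.coreForm g (h.adCore (J e₂) (h.adCore (J e₂) u)) u
        + h.coreForm g (h.adCore (J e₂) u) (h.adCore (J e₂) u)) = 0 := by
    simp only [coreForm_apply, coe_adCore]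
    have p₁ := hg (J e₁) e₁ u (J u)
    have p₂ := hg (J e₂) e₂ u (J u)
    rw [h.ddcOmega_invCore g h.left_mem u.2] at p₁
    rw [h.ddcOmega_invCore g h.right_mem u.2] at p₂
    have hsum : g.dcOmega ⁅J e₁, e₁⁆ u (J u) + g.dcOmega ⁅J e₂, e₂⁆ u (J u)
        = g.dcOmega (⁅J e₁, e₁⁆ + ⁅J e₂, e₂⁆) u (J u) := by
      simp only [HermMetric.dcOmega, HermMetric.dOmega, HermMetric.omega, map_add, add_lie,
        LinearMap.add_apply]
      ring
    have hJu := h.J_mem u.2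
    have hz : g.dcOmega (s • ⁅J e₁, J e₂⁆) u (J u) = 0 := by
      rw [HermMetric.dcOmega, map_smul, h.dOmega_eq_zero g (a.smul_mem s h.J_lie_J_J_mem)
        hJu.1 hJu.2, neg_zero]
    rw [hb, hz] at hsum
    linarith
  obtain ⟨k₁, k₂⟩ := skew_of_form _ (h.coreForm_symm g) (h.coreForm_posdef g) _ _ key
  have hx (w : invCore J a) :
      h.adCore x w = ξ₁ x • h.adCore (J e₁) w + ξ₂ x • h.adCore (J e₂) w :=
    Subtype.ext (h.lie_eq x w.2.1)
  rw [hx, hx]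
  simp only [map_add, map_smul, LinearMap.add_apply, LinearMap.smul_apply, smul_eq_mul]
  linear_combination ξ₁ x * k₁ u v + ξ₂ x * k₂ u v

/-- The projection onto the maximal `J`-invariant subspace of `a` along the span of
`e₁, e₂, J e₁, J e₂`. -/
def coreProj : L →ₗ[ℝ] invCore J a :=
  (LinearMap.id - (ξ₁.smulRight (J e₁) + ξ₂.smulRight (J e₂))
    - ((ξ₁ ∘ₗ J).smulRight e₁ + (ξ₂ ∘ₗ J).smulRight e₂)).codRestrict (invCore J a) fun y => by
      have hy := h.sub_mem_invCore (h.sub_mem_ideal y)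
      simpa [h.sq, (h.ξ_mem h.left_mem).1, (h.ξ_mem h.left_mem).2, (h.ξ_mem h.right_mem).1,
        (h.ξ_mem h.right_mem).2] using hy

theorem coe_coreProj (y : L) : (h.coreProj y : L) = y - (ξ₁ y • J e₁ + ξ₂ y • J e₂)
    - (ξ₁ (J y) • e₁ + ξ₂ (J y) • e₂) := rfl

theorem coreProj_coe (u : invCore J a) : h.coreProj u = u := by
  ext
  rw [coe_coreProj]
  simp [(h.ξ_mem u.2.1).1, (h.ξ_mem u.2.1).2, (h.ξ_mem u.2.2).1, (h.ξ_mem u.2.2).2]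

/-- The trace of `ad x`, computed along the decomposition of `L` defined by the frame. -/
theorem trace_ad [FiniteDimensional ℝ L] (x : L) :
    LinearMap.trace ℝ L (LieAlgebra.ad ℝ L x) = LinearMap.trace ℝ _ (h.adCore x)
      + (ξ₁ ⁅x, J e₁⁆ + ξ₂ ⁅x, J e₂⁆ + ξ₁ (J ⁅x, e₁⁆) + ξ₂ (J ⁅x, e₂⁆)) := by
  have hT : (LieAlgebra.ad ℝ L x : L →ₗ[ℝ] L)
      = (LieAlgebra.ad ℝ L x ∘ₗ (invCore J a).subtype) ∘ₗ h.coreProj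
        + (ξ₁.smulRight ⁅x, J e₁⁆ + ξ₂.smulRight ⁅x, J e₂⁆
        + (ξ₁ ∘ₗ J).smulRight ⁅x, e₁⁆ + (ξ₂ ∘ₗ J).smulRight ⁅x, e₂⁆) := by
    ext y
    simp only [LinearMap.add_apply, LinearMap.comp_apply, LinearMap.smulRight_apply,
      Submodule.subtype_apply, coe_coreProj, map_sub, map_add, map_smul, LieAlgebra.ad_apply]
    abel
  have hc : h.coreProj ∘ₗ LieAlgebra.ad ℝ L x ∘ₗ (invCore J a).subtype = h.adCore x :=
    LinearMap.ext fun u => h.coreProj_coe (h.adCore x u)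
  rw [hT, map_add, LinearMap.trace_comp_comm', hc]
  simp

theorem mem_invCore_iff {v : L} (hv : v ∈ a) : v ∈ invCore J a ↔ ξ₁ (J v) = 0 ∧ ξ₂ (J v) = 0 := by
  rw [mem_invCore, h.mem_iff (J v), and_iff_right hv]

/-- The action of `ad x` on `a` modulo the maximal `J`-invariant subspace. -/
theorem ξ_J_lie (x : L) {v : L} (hv : v ∈ a) :
    ξ₁ (J ⁅x, v⁆) = ξ₁ (J v) * ξ₁ (J ⁅x, e₁⁆) + ξ₂ (J v) * ξ₁ (J ⁅x, e₂⁆) ∧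
    ξ₂ (J ⁅x, v⁆) = ξ₁ (J v) * ξ₂ (J ⁅x, e₁⁆) + ξ₂ (J v) * ξ₂ (J ⁅x, e₂⁆) := by
  have := h.ξ_mem (h.lie_mem_invCore x (h.sub_mem_invCore hv)).2
  simpa [sub_eq_zero] using this

theorem ξ_J_jacobi {e : L} (he : e ∈ a) :
    ξ₁ ⁅J e₁, J e₂⁆ • ⁅J e₁, e⁆ + ξ₂ ⁅J e₁, J e₂⁆ • ⁅J e₂, e⁆
      = ⁅J e₁, ⁅J e₂, e⁆⁆ - ⁅J e₂, ⁅J e₁, e⁆⁆ := by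
  rw [← h.lie_eq _ he, lie_lie]

/-- If `L` is unimodular, the balanced identity together with tracelessness of the action on the
maximal `J`-invariant subspace of `a` forces `ad` to map `a` into that subspace. -/
theorem lie_mem_invCore_of_isUnimodularLie [FiniteDimensional ℝ L] (huni : IsUnimodularLie L)
    (htr : ∀ x, LinearMap.trace ℝ _ (h.adCore x) = 0)
    {s : ℝ} (hb : ⁅J e₁, e₁⁆ + ⁅J e₂, e₂⁆ = s • ⁅J e₁, J e₂⁆) :
    ⁅J e₁, J e₂⁆ ∈ invCore J a ∧ (∀ x : L, ⁅x, e₁⁆ ∈ invCore J a) ∧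
      ∀ x : L, ⁅x, e₂⁆ ∈ invCore J a := by
  have mem (x : L) : (⁅x, e₁⁆ : L) ∈ a ∧ (⁅x, e₂⁆ : L) ∈ a :=
    ⟨a.lie_mem h.left_mem, a.lie_mem h.right_mem⟩
  have tr (x : L) := (h.trace_ad x).symm.trans (huni x)
  simp only [htr, zero_add] at tr
  have tr₁ := tr (J e₁)
  have tr₂ := tr (J e₂)
  rw [lie_self, map_zero, zero_add] at tr₁
  rw [lie_self, map_zero, add_zero, ← lie_skew, map_neg] at tr₂
  have hW : ⁅J e₁, J e₂⁆ = J ⁅J e₁, e₂⁆ - J ⁅J e₂, e₁⁆ := by rw [h.lie_J_J, map_sub]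
  have c₁ := congrArg ξ₁ hW
  have c₂ := congrArg ξ₂ hW
  rw [map_sub] at c₁ c₂
  have b₁ := congrArg (ξ₁ ∘ J) hb
  have b₂ := congrArg (ξ₂ ∘ J) hb
  simp only [Function.comp_apply, map_add, map_smul, (h.ξ_mem h.J_lie_J_J_mem).1,
    (h.ξ_mem h.J_lie_J_J_mem).2, smul_zero] at b₁ b₂
  have j₁ := congrArg (ξ₁ ∘ J) (h.ξ_J_jacobi h.right_mem)
  have j₂ := congrArg (ξ₂ ∘ J) (h.ξ_J_jacobi h.left_mem)
  simp only [Function.comp_apply, map_add, map_sub, map_smul, smul_eq_mul,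
    (h.ξ_J_lie (J e₁) (mem (J e₂)).2).1, (h.ξ_J_lie (J e₂) (mem (J e₁)).2).1] at j₁
  simp only [Function.comp_apply, map_add, map_sub, map_smul, smul_eq_mul,
    (h.ξ_J_lie (J e₁) (mem (J e₂)).1).2, (h.ξ_J_lie (J e₂) (mem (J e₁)).1).2] at j₂
  have hiff (x e : L) (he : e ∈ a) := h.mem_invCore_iff (a.lie_mem (x := x) he)
  have W_iff : ⁅J e₁, J e₂⁆ ∈ invCore J a ↔ ξ₁ ⁅J e₁, J e₂⁆ = 0 ∧ ξ₂ ⁅J e₁, J e₂⁆ = 0 := by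
    rw [mem_invCore, and_iff_left h.J_lie_J_J_mem, h.mem_iff]
  suffices hs : ⁅J e₁, J e₂⁆ ∈ invCore J a ∧
      (⁅J e₁, e₁⁆ ∈ invCore J a ∧ ⁅J e₂, e₁⁆ ∈ invCore J a) ∧
      ⁅J e₁, e₂⁆ ∈ invCore J a ∧ ⁅J e₂, e₂⁆ ∈ invCore J a by
    obtain ⟨hs, ⟨h₁, h₂⟩, h₃, h₄⟩ := hs
    refine ⟨hs, fun x => ?_, fun x => ?_⟩
    · rw [h.lie_eq x h.left_mem]
      exact add_mem (Submodule.smul_mem _ _ h₁) (Submodule.smul_mem _ _ h₂)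
    · rw [h.lie_eq x h.right_mem]
      exact add_mem (Submodule.smul_mem _ _ h₃) (Submodule.smul_mem _ _ h₄)
  rw [W_iff, hiff _ _ h.left_mem, hiff _ _ h.left_mem, hiff _ _ h.right_mem, hiff _ _ h.right_mem]
  generalize ξ₁ ⁅J e₁, J e₂⁆ = C₁, ξ₂ ⁅J e₁, J e₂⁆ = C₂ at *
  generalize ξ₁ (J ⁅J e₁, e₁⁆) = p, ξ₂ (J ⁅J e₁, e₁⁆) = q, ξ₁ (J ⁅J e₁, e₂⁆) = m₁,
    ξ₂ (J ⁅J e₁, e₂⁆) = m₂, ξ₁ (J ⁅J e₂, e₁⁆) = n₁, ξ₂ (J ⁅J e₂, e₁⁆) = n₂,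
    ξ₁ (J ⁅J e₂, e₂⁆) = r₁, ξ₂ (J ⁅J e₂, e₂⁆) = r₂ at *
  obtain rfl : r₁ = -p := by linarith
  obtain rfl : r₂ = -q := by linarith
  obtain rfl : n₁ = C₁ + q := by linarith
  obtain rfl : m₁ = 2 * C₁ + q := by linarith
  obtain rfl : m₂ = -C₂ - p := by linarith
  obtain rfl : n₂ = -p - 2 * C₂ := by linarith
  have hsum : 2 * (p + 3 / 4 * C₂) ^ 2 + 7 / 8 * C₂ ^ 2
      + (2 * (q + 3 / 4 * C₁) ^ 2 + 7 / 8 * C₁ ^ 2) = 0 := by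
    linear_combination (j₁ - j₂) / 2
  have hC₁ : C₁ = 0 := by
    rw [← sq_eq_zero_iff]
    linarith [sq_nonneg C₁, sq_nonneg C₂, sq_nonneg (p + 3 / 4 * C₂), sq_nonneg (q + 3 / 4 * C₁)]
  have hC₂ : C₂ = 0 := by
    rw [← sq_eq_zero_iff]
    linarith [sq_nonneg C₁, sq_nonneg C₂, sq_nonneg (p + 3 / 4 * C₂), sq_nonneg (q + 3 / 4 * C₁)]
  subst hC₁ hC₂
  have hp : p = 0 := by
    rw [← sq_eq_zero_iff]
    linarith [sq_nonneg p, sq_nonneg q]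
  have hq : q = 0 := by
    rw [← sq_eq_zero_iff]
    linarith [sq_nonneg p, sq_nonneg q]
  simp [hp, hq]

theorem lie_lie_comm {e : L} (he : e ∈ a) (hW : ⁅J e₁, J e₂⁆ ∈ invCore J a) :
    ⁅J e₁, ⁅J e₂, e⁆⁆ = ⁅J e₂, ⁅J e₁, e⁆⁆ := by
  rw [← sub_eq_zero, ← lie_lie, h.lie_eq_zero _ hW.1 _ he]

/-- If the maximal `J`-invariant subspace of `a` is acted on by skew operators, then an element
of `a` mapped into it by `ad` can be translated so that `ad` annihilates its image. -/
theorem exists_lie_lie_sub_eq_zero [FiniteDimensional ℝ L] {g : HermMetric J}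
    (hg : ∀ x : L, ∀ u ∈ invCore J a, ∀ v ∈ invCore J a, g.B ⁅x, u⁆ v + g.B u ⁅x, v⁆ = 0)
    (hW : ⁅J e₁, J e₂⁆ ∈ invCore J a) {e : L} (he : e ∈ a)
    (hle : ∀ x : L, ⁅x, e⁆ ∈ invCore J a) :
    ∃ t ∈ invCore J a, ∀ x y : L, ⁅x, ⁅y, e - t⁆⁆ = 0 := by
  obtain ⟨t, k₁₁, k₂₁, k₁₂, k₂₂⟩ := exists_sub_mem_ker_of_skew (h.coreForm g) (h.coreForm_symm g)
    (h.coreForm_posdef g) (h.adCore (J e₁)) (h.adCore (J e₂))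
    (fun u v => hg _ u u.2 v v.2) (fun u v => hg _ u u.2 v v.2)
    (fun u => Subtype.ext (h.lie_lie_comm u.2.1 hW)) ⟨_, hle (J e₁)⟩ ⟨_, hle (J e₂)⟩
    (Subtype.ext (h.lie_lie_comm he hW))
  replace k₁₁ : ⁅J e₁, ⁅J e₁, e⁆ - ⁅J e₁, (t : L)⁆⁆ = 0 := congrArg Subtype.val k₁₁
  replace k₂₁ : ⁅J e₂, ⁅J e₁, e⁆ - ⁅J e₁, (t : L)⁆⁆ = 0 := congrArg Subtype.val k₂₁
  replace k₁₂ : ⁅J e₁, ⁅J e₂, e⁆ - ⁅J e₂, (t : L)⁆⁆ = 0 := congrArg Subtype.val k₁₂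
  replace k₂₂ : ⁅J e₂, ⁅J e₂, e⁆ - ⁅J e₂, (t : L)⁆⁆ = 0 := congrArg Subtype.val k₂₂
  rw [← lie_sub] at k₁₁ k₂₁ k₁₂ k₂₂
  refine ⟨t, t.2, fun x y => ?_⟩
  have ht : e - t ∈ a := a.sub_mem he t.2.1
  rw [h.lie_eq x (a.lie_mem ht), h.lie_eq y ht]
  simp only [lie_add, lie_smul, k₁₁, k₂₁, k₁₂, k₂₂, smul_zero, add_zero]

theorem lie_sub_mem_invCore {e t : L} (he : ∀ x : L, ⁅x, e⁆ ∈ invCore J a)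
    (ht : t ∈ invCore J a) (x : L) : ⁅x, e - t⁆ ∈ invCore J a := by
  rw [lie_sub]
  exact sub_mem (he x) (h.lie_mem_invCore x ht)

theorem translate {t₁ t₂ : L} (ht₁ : t₁ ∈ invCore J a) (ht₂ : t₂ ∈ invCore J a) :
    IsFrame J a (e₁ - t₁) (e₂ - t₂) ξ₁ ξ₂ where
  lie_eq_zero := h.lie_eq_zero
  sq := h.sq
  integrable := h.integrable
  left_mem := a.sub_mem h.left_mem ht₁.1
  right_mem := a.sub_mem h.right_mem ht₂.1
  ξ₁_left := by rw [map_sub, map_sub, h.ξ₁_left, (h.ξ_mem ht₁.2).1, sub_zero]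
  ξ₁_right := by rw [map_sub, map_sub, h.ξ₁_right, (h.ξ_mem ht₂.2).1, sub_zero]
  ξ₂_left := by rw [map_sub, map_sub, h.ξ₂_left, (h.ξ_mem ht₁.2).2, sub_zero]
  ξ₂_right := by rw [map_sub, map_sub, h.ξ₂_right, (h.ξ_mem ht₂.2).2, sub_zero]
  mem_iff := h.mem_iff

theorem lie_lie_J_J_eq_zero (hc₁ : ∀ x : L, ⁅x, e₁⁆ ∈ invCore J a)
    (hc₂ : ∀ x : L, ⁅x, e₂⁆ ∈ invCore J a)
    (hz₁ : ∀ x y : L, ⁅x, ⁅y, e₁⁆⁆ = 0) (hz₂ : ∀ x y : L, ⁅x, ⁅y, e₂⁆⁆ = 0) (x : L) :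
    ⁅x, ⁅J e₁, J e₂⁆⁆ = 0 := by
  rw [h.lie_J_J, h.lie_J x (sub_mem (hc₂ _) (hc₁ _)), lie_sub, hz₁, hz₂, sub_zero, map_zero]

/-- The balanced identity survives a translation of the frame that makes the images of `ad`
on `e₁` and `e₂` central. -/
theorem sum_lie_sub_eq {g : HermMetric J}
    (hg : ∀ x : L, ∀ u ∈ invCore J a, ∀ v ∈ invCore J a, g.B ⁅x, u⁆ v + g.B u ⁅x, v⁆ = 0)
    (hc₁ : ∀ x : L, ⁅x, e₁⁆ ∈ invCore J a) (hc₂ : ∀ x : L, ⁅x, e₂⁆ ∈ invCore J a)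
    {t₁ t₂ : L} (ht₁ : t₁ ∈ invCore J a) (ht₂ : t₂ ∈ invCore J a)
    (hz₁ : ∀ x y : L, ⁅x, ⁅y, e₁ - t₁⁆⁆ = 0) (hz₂ : ∀ x y : L, ⁅x, ⁅y, e₂ - t₂⁆⁆ = 0)
    {s : ℝ} (hb : ⁅J e₁, e₁⁆ + ⁅J e₂, e₂⁆ = s • ⁅J e₁, J e₂⁆) :
    ⁅J (e₁ - t₁), e₁ - t₁⁆ + ⁅J (e₂ - t₂), e₂ - t₂⁆ = s • ⁅J (e₁ - t₁), J (e₂ - t₂)⁆ := by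
  have hker (x : L) : ⁅x, ⁅J (e₁ - t₁), e₁ - t₁⁆ + ⁅J (e₂ - t₂), e₂ - t₂⁆
      - s • ⁅J (e₁ - t₁), J (e₂ - t₂)⁆⁆ = 0 := by
    rw [lie_sub, lie_add, lie_smul, hz₁, hz₂,
      (h.translate ht₁ ht₂).lie_lie_J_J_eq_zero (h.lie_sub_mem_invCore hc₁ ht₁)
        (h.lie_sub_mem_invCore hc₂ ht₂) hz₁ hz₂]
    simp
  have hu₁ := sub_mem (Submodule.smul_mem _ s (h.J_mem ht₂)) ht₁
  have hu₂ := neg_mem (add_mem ht₂ (Submodule.smul_mem _ s (h.J_mem ht₁)))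
  have hR : ⁅J (e₁ - t₁), e₁ - t₁⁆ + ⁅J (e₂ - t₂), e₂ - t₂⁆ - s • ⁅J (e₁ - t₁), J (e₂ - t₂)⁆
      = ⁅J e₁, s • J t₂ - t₁⁆ + ⁅J e₂, -(t₂ + s • J t₁)⁆ := by
    simp only [map_sub, sub_lie, lie_sub, lie_neg, lie_add, lie_smul,
      h.lie_eq_zero _ ht₁.2 _ h.left_mem, h.lie_eq_zero _ ht₂.2 _ h.right_mem,
      h.lie_eq_zero _ ht₁.2 _ ht₁.1, h.lie_eq_zero _ ht₂.2 _ ht₂.1,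
      h.lie_eq_zero _ ht₁.2 _ ht₂.2, ← lie_skew (J t₁) (J e₂)]
    linear_combination (norm := module) hb
  rw [← sub_eq_zero]
  by_contra hne
  apply (g.posdef _ hne).ne'
  have hRm := add_mem (h.lie_mem_invCore (J e₁) hu₁) (h.lie_mem_invCore (J e₂) hu₂)
  have k₁ := hg (J e₁) _ hu₁ _ hRm
  have k₂ := hg (J e₂) _ hu₂ _ hRm
  rw [← hR, hker, map_zero, add_zero] at k₁ k₂
  conv_lhs => enter [1]; rw [hR]
  rw [map_add, LinearMap.add_apply, k₁, k₂, add_zero]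

theorem dcOmega_of_central {g : HermMetric J} {v : L} (hv : v ∈ invCore J a)
    (hz : ∀ x : L, ⁅x, v⁆ = 0) (y z : L) : g.dcOmega v y z = g.B ⁅J y, J z⁆ v := by
  have hJv (x : L) : ⁅J v, x⁆ = 0 := by rw [← lie_skew, h.lie_J x hv, hz, map_zero, neg_zero]
  simp [HermMetric.dcOmega, HermMetric.dOmega, HermMetric.omega, hJv, g.compat]

/-- For a pluriclosed metric, a frame whose brackets are central and that satisfies the balanced
identity has vanishing brackets. -/
theorem lie_eq_zero_of_isPluriclosed {g : HermMetric J} (hg : g.IsPluriclosed)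
    (hc₁ : ∀ x : L, ⁅x, e₁⁆ ∈ invCore J a) (hc₂ : ∀ x : L, ⁅x, e₂⁆ ∈ invCore J a)
    (hz₁ : ∀ x y : L, ⁅x, ⁅y, e₁⁆⁆ = 0) (hz₂ : ∀ x y : L, ⁅x, ⁅y, e₂⁆⁆ = 0)
    {s : ℝ} (hs : s ^ 2 < 1) (hb : ⁅J e₁, e₁⁆ + ⁅J e₂, e₂⁆ = s • ⁅J e₁, J e₂⁆) :
    ⁅J e₁, J e₂⁆ = 0 ∧ (∀ x : L, ⁅x, e₁⁆ = 0) ∧ ∀ x : L, ⁅x, e₂⁆ = 0 := by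
  have hW : ⁅J e₁, J e₂⁆ ∈ invCore J a := by
    rw [h.lie_J_J]
    exact h.J_mem (sub_mem (hc₂ _) (hc₁ _))
  have hzW := h.lie_lie_J_J_eq_zero hc₁ hc₂ hz₁ hz₂
  have key := hg (J e₁) e₁ (J e₂) e₂
  have z (x y : L) : g.dcOmega 0 x y = 0 := by
    simp [HermMetric.dcOmega, HermMetric.dOmega, HermMetric.omega]
  have neg (v x y : L) : g.dcOmega (-v) x y = -g.dcOmega v x y := by
    simp only [HermMetric.dcOmega, HermMetric.dOmega, HermMetric.omega, neg_lie, map_neg,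
      LinearMap.neg_apply]
    ring
  rw [HermMetric.ddcOmega, h.lie_eq_zero e₁ h.left_mem e₂ h.right_mem, z, ← lie_skew e₁ (J e₂),
    neg, h.dcOmega_of_central (hc₁ _) fun x => hz₁ x _, h.dcOmega_of_central hW hzW,
    h.dcOmega_of_central (hc₂ _) fun x => hz₂ x _, h.dcOmega_of_central (hc₁ _) fun x => hz₁ x _,
    h.dcOmega_of_central (hc₂ _) fun x => hz₂ x _, h.sq, h.sq] at key
  simp only [neg_lie, lie_neg, ← lie_skew e₁ (J e₁), ← lie_skew e₂ (J e₂), ← lie_skew e₁ (J e₂),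
    neg_neg, map_neg, LinearMap.neg_apply] at key
  have hbb := congrArg (fun v => g.B v v) hb
  simp only [map_add, map_smul, LinearMap.add_apply, LinearMap.smul_apply, smul_eq_mul] at hbb
  have nonneg (v : L) : 0 ≤ g.B v v := by
    by_cases hv : v = 0
    · simp [hv]
    · exact (g.posdef v hv).le
  have eq_zero {v : L} (hv : g.B v v ≤ 0) : v = 0 := by
    by_contra hne
    exact hv.not_gt (g.posdef v hne)
  have hsymm := g.symm ⁅J e₁, e₁⁆ ⁅J e₂, e₂⁆
  have hW_nonneg := mul_nonneg (sub_nonneg.2 hs.le) (nonneg ⁅J e₁, J e₂⁆)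
  have n₁₁ := nonneg ⁅J e₁, e₁⁆
  have n₁₂ := nonneg ⁅J e₁, e₂⁆
  have n₂₁ := nonneg ⁅J e₂, e₁⁆
  have n₂₂ := nonneg ⁅J e₂, e₂⁆
  have z₁₁ : ⁅J e₁, e₁⁆ = 0 := eq_zero (by linarith)
  have z₁₂ : ⁅J e₁, e₂⁆ = 0 := eq_zero (by linarith)
  have z₂₁ : ⁅J e₂, e₁⁆ = 0 := eq_zero (by linarith)
  have z₂₂ : ⁅J e₂, e₂⁆ = 0 := eq_zero (by linarith)
  refine ⟨by rw [h.lie_J_J, z₁₂, z₂₁, sub_zero, map_zero], fun x => ?_, fun x => ?_⟩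
  · rw [h.lie_eq x h.left_mem, z₁₁, z₂₁, smul_zero, smul_zero, add_zero]
  · rw [h.lie_eq x h.right_mem, z₁₂, z₂₂, smul_zero, smul_zero, add_zero]

/-- A Hermitian metric for which the frame is orthonormal and orthogonal to the maximal
`J`-invariant subspace of `a`, on which it agrees with `g`. -/
def metric (g : HermMetric J) : HermMetric J where
  B := (h.coreForm g).compl₁₂ h.coreProj h.coreProj
    + (ξ₁.smulRight ξ₁ + ξ₂.smulRight ξ₂
      + (ξ₁ ∘ₗ J).smulRight (ξ₁ ∘ₗ J) + (ξ₂ ∘ₗ J).smulRight (ξ₂ ∘ₗ J))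
  symm x y := by
    simp [h.coreForm_symm g (h.coreProj x), mul_comm]
  posdef x hx := by
    simp only [LinearMap.add_apply, LinearMap.compl₁₂_apply, LinearMap.smulRight_apply,
      LinearMap.smul_apply, LinearMap.comp_apply, smul_eq_mul, ← pow_two]
    by_cases hP : h.coreProj x = 0
    · rw [hP, map_zero, zero_add]
      by_contra! hle
      obtain ⟨h₁, h₂, h₃, h₄⟩ : ξ₁ x = 0 ∧ ξ₂ x = 0 ∧ ξ₁ (J x) = 0 ∧ ξ₂ (J x) = 0 := by
        refine ⟨?_, ?_, ?_, ?_⟩ <;> rw [← sq_eq_zero_iff] <;>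
        linarith [sq_nonneg (ξ₁ x), sq_nonneg (ξ₂ x), sq_nonneg (ξ₁ (J x)), sq_nonneg (ξ₂ (J x))]
      apply hx
      have := congrArg Subtype.val hP
      simpa [coe_coreProj, h₁, h₂, h₃, h₄] using this
    · have := h.coreForm_posdef g _ hP
      positivity
  compat x y := by
    have hP (x : L) : (h.coreProj (J x) : L) = J (h.coreProj x) := by
      simp only [coe_coreProj, map_sub, map_add, map_smul, h.sq, map_neg]
      module
    simp only [LinearMap.add_apply, LinearMap.compl₁₂_apply, LinearMap.smulRight_apply,
      LinearMap.smul_apply, LinearMap.comp_apply, smul_eq_mul, coreForm_apply, hP, g.compat, h.sq,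
      map_neg]
    ring

theorem metric_omega (g : HermMetric J) {v : L} (hv : v ∈ invCore J a) (z : L) :
    (h.metric g).omega v z = g.B (J v) (h.coreProj z) := by
  have hJv := h.J_mem hv
  have hP : h.coreProj (J v) = ⟨J v, hJv⟩ := h.coreProj_coe ⟨J v, hJv⟩
  simp [HermMetric.omega, metric, hP, coreForm_apply, (h.ξ_mem hJv.1).1, (h.ξ_mem hJv.1).2,
    (h.ξ_mem hJv.2).1, (h.ξ_mem hJv.2).2]

/-- If all brackets of the frame vanish, then the bracket of `L` is determined by the action on
the maximal `J`-invariant subspace of `a`. -/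
theorem lie_eq_sub_lie (hW : ⁅J e₁, J e₂⁆ = 0) (hz₁ : ∀ x : L, ⁅x, e₁⁆ = 0)
    (hz₂ : ∀ x : L, ⁅x, e₂⁆ = 0) (x y : L) :
    ⁅x, y⁆ = ⁅x, (h.coreProj y : L)⁆ - ⁅y, (h.coreProj x : L)⁆ := by
  have hd (x : L) : x = h.coreProj x + (ξ₁ x • J e₁ + ξ₂ x • J e₂)
      + (ξ₁ (J x) • e₁ + ξ₂ (J x) • e₂) := by
    rw [coe_coreProj]
    abel
  have hr (x y : L) : ⁅x, y⁆ = ⁅x, (h.coreProj y : L)⁆ + (ξ₁ y • ⁅x, J e₁⁆ + ξ₂ y • ⁅x, J e₂⁆) := by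
    conv_lhs => rw [hd y]
    simp [hz₁, hz₂]
  have h₁ : ⁅x, J e₁⁆ = -⁅J e₁, (h.coreProj x : L)⁆ := by
    rw [← lie_skew, hr, lie_self, hW]
    simp
  have h₂ : ⁅x, J e₂⁆ = -⁅J e₂, (h.coreProj x : L)⁆ := by
    rw [← lie_skew, hr, lie_self, ← lie_skew (J e₂) (J e₁), hW]
    simp
  rw [hr, h₁, h₂, h.lie_eq y (h.coreProj x).2.1]
  module

/-- If all brackets of the frame vanish and `g` is invariant on the maximal `J`-invariant subspace
of `a`, then the adapted metric is Kähler. -/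
theorem metric_isKahler {g : HermMetric J}
    (hg : ∀ x : L, ∀ u ∈ invCore J a, ∀ v ∈ invCore J a, g.B ⁅x, u⁆ v + g.B u ⁅x, v⁆ = 0)
    (hW : ⁅J e₁, J e₂⁆ = 0) (hz₁ : ∀ x : L, ⁅x, e₁⁆ = 0) (hz₂ : ∀ x : L, ⁅x, e₂⁆ = 0) :
    (h.metric g).IsKahler := by
  intro x y z
  have hm (x y : L) : ⁅x, (h.coreProj y : L)⁆ ∈ invCore J a := h.lie_mem_invCore x (h.coreProj y).2
  have hω (x y z : L) : g.B (J ⁅x, (h.coreProj y : L)⁆) (h.coreProj z)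
      = g.B (J ⁅x, (h.coreProj z : L)⁆) (h.coreProj y) := by
    have := hg x _ (h.J_mem (h.coreProj y).2) _ (h.coreProj z).2
    rw [h.lie_J x (h.coreProj y).2, g.apply_J_left h.sq (h.coreProj y : L),
      g.symm (h.coreProj y : L)] at this
    linarith
  simp only [HermMetric.dOmega, h.lie_eq_sub_lie hW hz₁ hz₂ x y, h.lie_eq_sub_lie hW hz₁ hz₂ x z,
    h.lie_eq_sub_lie hW hz₁ hz₂ y z, h.metric_omega g (sub_mem (hm _ _) (hm _ _)), map_sub,
    LinearMap.sub_apply, hω x y z, hω y x z, hω z x y]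
  ring

end IsFrame

end Lie

theorem fino_vezzoni_stmt0
    {L : Type*} [LieRing L] [LieAlgebra ℝ L] [FiniteDimensional ℝ L]
    (a : LieIdeal ℝ L)
    (habel : ∀ u ∈ a.toSubmodule, ∀ v ∈ a.toSubmodule, ⁅u, v⁆ = (0 : L))
    (hcodim : finrank ℝ ↥a.toSubmodule + 2 = finrank ℝ L)
    (J : L →ₗ[ℝ] L) (hJ : IsComplexStructure J)
    (huni : IsUnimodularLie L)
    (n : ℕ) (hdim : finrank ℝ L = 2 * n)
    (hJa : a.toSubmodule.map J ≠ a.toSubmodule)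
    (hbal : ∃ g : HermMetric J, g.IsBalanced n)
    (hplu : ∃ g : HermMetric J, g.IsPluriclosed) :
    ∃ g : HermMetric J, g.IsKahler := by
  obtain ⟨g, hg⟩ := hbal
  obtain ⟨k, hk⟩ := hplu
  obtain ⟨e₁, he₁, e₂, he₂, s, hs, hb, ξ₁, ξ₂, h₁₁, h₁₂, h₂₁, h₂₂, hmem⟩ :=
    exists_frame_sum_eq_of_form g.B g.symm g.posdef J hJ.1 g.compat a.toSubmodule hcodim hJa
      (LieAlgebra.ad ℝ L : L →ₗ[ℝ] L →ₗ[ℝ] L) (fun x => lie_self x) habel hdim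
      (hg.sum_lie_eq_zero hJ.1 huni)
  have h : IsFrame J a e₁ e₂ ξ₁ ξ₂ := ⟨habel, hJ.1, hJ.2, he₁, he₂, h₁₁, h₁₂, h₂₁, h₂₂, hmem⟩
  have hskew := h.skew_of_isPluriclosed hk hb
  obtain ⟨hW, hc₁, hc₂⟩ := h.lie_mem_invCore_of_isUnimodularLie huni
    (fun x => trace_eq_zero_of_skew _ (h.coreForm_symm k) (h.coreForm_posdef k) _ (hskew x)) hb
  have hinv (x : L) (u : L) (hu : u ∈ invCore J a) (v : L) (hv : v ∈ invCore J a) :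
      k.B ⁅x, u⁆ v + k.B u ⁅x, v⁆ = 0 := hskew x ⟨u, hu⟩ ⟨v, hv⟩
  obtain ⟨t₁, ht₁, hz₁⟩ := h.exists_lie_lie_sub_eq_zero hinv hW he₁ hc₁
  obtain ⟨t₂, ht₂, hz₂⟩ := h.exists_lie_lie_sub_eq_zero hinv hW he₂ hc₂
  have h' := h.translate ht₁ ht₂
  have hb' := h.sum_lie_sub_eq hinv hc₁ hc₂ ht₁ ht₂ hz₁ hz₂ hb
  obtain ⟨z, z₁, z₂⟩ := h'.lie_eq_zero_of_isPluriclosed hk (h.lie_sub_mem_invCore hc₁ ht₁)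
    (h.lie_sub_mem_invCore hc₂ ht₂) hz₁ hz₂ hs hb'
  exact ⟨h'.metric k, h'.metric_isKahler hinv z z₁ z₂⟩
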